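/- Let b be a rational function in the closed unit ball of H∞ with ‖b‖∞ = 1 that is not a finite Blaschke product, with pythagorean mate a whose distinct zeros on T are ξ₁,…,ξ_n. Let φ ∈ H(b) ∩ ball(H∞) and assume that for every 1 ≤ j ≤ n, limsup_{z→ξ_j} |φ(z)| < 1. Then the composition operator C_φ is bounded on H(b). -/

import Mathlib

open Complex MeasureTheory Set Filter

noncomputable section

attribute [local instance] Classical.propDecidable

/-- The open unit disk in `ℂ`. -/
def unitDisk : Set ℂ := Metric.ball 0 1

/-- The unit circle in `ℂ`. -/
def unitCircle : Set ℂ := Metric.sphere 0 1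

/-- Membership in `H^∞`: analytic and bounded on the unit disk. -/
def MemHinf (f : ℂ → ℂ) : Prop :=
  DifferentiableOn ℂ f unitDisk ∧ ∃ C : ℝ, ∀ z ∈ unitDisk, ‖f z‖ ≤ C

/-- Membership in the closed unit ball of `H^∞`. -/
def MemBallHinf (f : ℂ → ℂ) : Prop :=
  DifferentiableOn ℂ f unitDisk ∧ ∀ z ∈ unitDisk, ‖f z‖ ≤ 1

/-- `f` agrees on the closed unit disk with a rational function without poles there. -/
def IsRationalOnDisk (f : ℂ → ℂ) : Prop :=
  ∃ P Q : Polynomial ℂ, ∀ z ∈ Metric.closedBall (0:ℂ) 1,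
    Q.eval z ≠ 0 ∧ f z = P.eval z / Q.eval z

/-- `f` is a finite Blaschke product (multiplicities are encoded by repetition). -/
def IsFiniteBlaschke (f : ℂ → ℂ) : Prop :=
  ∃ (γ : ℂ) (k : ℕ) (lam : Fin k → ℂ), ‖γ‖ = 1 ∧ (∀ i, lam i ∈ unitDisk) ∧
    ∀ z ∈ unitDisk, f z = γ * ∏ i, (z - lam i) / (1 - (starRingEnd ℂ) (lam i) * z)

/-- The `k`-th Taylor coefficient of `f` at the origin. -/
def taylorCoeff (f : ℂ → ℂ) (k : ℕ) : ℂ := iteratedDeriv k f 0 / k.factorial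

/-- Membership in the Hardy space `H²` (square-summable Taylor coefficients). -/
def MemH2 (f : ℂ → ℂ) : Prop :=
  DifferentiableOn ℂ f unitDisk ∧ Summable fun k => ‖taylorCoeff f k‖ ^ 2

/-- The squared `H²` norm. -/
def h2NormSq (f : ℂ → ℂ) : ℝ := ∑' k, ‖taylorCoeff f k‖ ^ 2

/-- The `H²` inner product. -/
def h2Inner (f g : ℂ → ℂ) : ℂ :=
  ∑' k, (starRingEnd ℂ) (taylorCoeff f k) * taylorCoeff g k

/-- The polynomial `a₁(z) = ∏ⱼ (z − ξⱼ)^{mⱼ}`. -/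
def a1fun {n : ℕ} (ξ : Fin n → ℂ) (m : Fin n → ℕ) : ℂ → ℂ :=
  fun z => ∏ j, (z - ξ j) ^ (m j)

/-- A decomposition `f = a₁ g + q` with `g ∈ H²`, `deg q ≤ N − 1`, witnessing membership
in `H(b) = a₁H² ⊕ P_{N−1}`. -/
def HbDecompOf {n : ℕ} (ξ : Fin n → ℂ) (m : Fin n → ℕ)
    (f g : ℂ → ℂ) (q : Polynomial ℂ) : Prop :=
  MemH2 g ∧ q.degree < ((∑ j, m j : ℕ) : WithBot ℕ) ∧
    ∀ z ∈ unitDisk, f z = a1fun ξ m z * g z + q.eval z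

/-- Membership in `H(b) = a₁ H² ⊕ P_{N−1}` (description of `H(b)` for `b` rational,
not a finite Blaschke product, whose pythagorean mate has boundary zeros `ξ` with
multiplicities `m`). -/
def MemHb {n : ℕ} (ξ : Fin n → ℂ) (m : Fin n → ℕ) (f : ℂ → ℂ) : Prop :=
  ∃ gq : (ℂ → ℂ) × Polynomial ℂ, HbDecompOf ξ m f gq.1 gq.2

/-- The (unique) decomposition of a member of `H(b)`. -/
def hbDecomp {n : ℕ} (ξ : Fin n → ℂ) (m : Fin n → ℕ) (f : ℂ → ℂ) :
    (ℂ → ℂ) × Polynomial ℂ :=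
  if h : MemHb ξ m f then h.choose else (0, 0)

/-- The squared norm `⦀a₁g + q⦀² = ‖g‖²_{H²} + ‖q‖²_{H²}` on `H(b)`. -/
def hbNormSq {n : ℕ} (ξ : Fin n → ℂ) (m : Fin n → ℕ) (f : ℂ → ℂ) : ℝ :=
  h2NormSq (hbDecomp ξ m f).1 + h2NormSq fun z => ((hbDecomp ξ m f).2).eval z

/-- The inner product on `H(b)` induced by the decomposition. -/
def hbInner {n : ℕ} (ξ : Fin n → ℂ) (m : Fin n → ℕ) (f g : ℂ → ℂ) : ℂ :=
  h2Inner (hbDecomp ξ m f).1 (hbDecomp ξ m g).1 +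
    h2Inner (fun z => ((hbDecomp ξ m f).2).eval z)
      (fun z => ((hbDecomp ξ m g).2).eval z)

/-- The Stolz angle (non-tangential approach region) at a boundary point `ξ`. -/
def stolzAngle (ξ : ℂ) (M : ℝ) : Set ℂ := {z ∈ unitDisk | ‖z - ξ‖ ≤ M * (1 - ‖z‖)}

/-- `f` has non-tangential limit `L` at `ξ`. -/
def NTLimit (f : ℂ → ℂ) (ξ L : ℂ) : Prop :=
  ∀ M : ℝ, 1 < M → Tendsto f (nhdsWithin ξ (stolzAngle ξ M)) (nhds L)

/-- Radial boundary value of `f` at `ζ` (junk value if the radial limit does not exist). -/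
def bdryVal (f : ℂ → ℂ) (ζ : ℂ) : ℂ :=
  limUnder (nhdsWithin (1:ℝ) (Set.Iio 1)) fun r : ℝ => f ((r : ℂ) * ζ)

/-- The full setting: `b` is a rational function in the closed unit ball of `H^∞` with
`‖b‖_∞ = 1` which is not a finite Blaschke product; `a` is its pythagorean mate (rational,
outer — i.e. zero-free on the disk —, `a(0) > 0`, `|a|² + |b|² = 1` on the circle); the
`ξ j` are the distinct zeros of `a` on the unit circle, with multiplicities `m j`. -/
structure RationalSetting (b a : ℂ → ℂ) (n : ℕ) (ξ : Fin n → ℂ) (m : Fin n → ℕ) :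
    Prop where
  b_diff : DifferentiableOn ℂ b unitDisk
  b_rat : IsRationalOnDisk b
  b_le_one : ∀ z ∈ unitDisk, ‖b z‖ ≤ 1
  b_norm_one : sSup ((fun z => ‖b z‖) '' unitDisk) = 1
  b_not_fbp : ¬ IsFiniteBlaschke b
  a_diff : DifferentiableOn ℂ a unitDisk
  a_rat : IsRationalOnDisk a
  a_outer : ∀ z ∈ unitDisk, a z ≠ 0
  a_zero_pos : 0 < (a 0).re ∧ (a 0).im = 0
  pyth : ∀ ζ ∈ unitCircle, ‖a ζ‖ ^ 2 + ‖b ζ‖ ^ 2 = 1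
  zeros_mem : ∀ j, ξ j ∈ unitCircle
  zeros_inj : Function.Injective ξ
  mult_pos : ∀ j, 0 < m j
  factor : ∃ g : ℂ → ℂ, IsRationalOnDisk g ∧ (∀ ζ ∈ unitCircle, g ζ ≠ 0) ∧
    ∀ z ∈ Metric.closedBall (0:ℂ) 1, a z = a1fun ξ m z * g z

/-- The composition operator `C_φ` maps `H(b)` into itself and is bounded there
(with respect to the equivalent norm `⦀·⦀_b`). -/
def CompBddHb {n : ℕ} (ξ : Fin n → ℂ) (m : Fin n → ℕ) (φ : ℂ → ℂ) : Prop :=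
  (∀ f, MemHb ξ m f → MemHb ξ m fun z => f (φ z)) ∧
  ∃ C : ℝ, ∀ f, MemHb ξ m f →
    hbNormSq ξ m (fun z => f (φ z)) ≤ C * hbNormSq ξ m f

/-- The composition operator `C_φ` is compact on `H(b)`: it is bounded and the image of
every sequence in the unit ball has a subsequence whose image converges in `H(b)`. -/
def CompCompactHb {n : ℕ} (ξ : Fin n → ℂ) (m : Fin n → ℕ) (φ : ℂ → ℂ) : Prop :=
  CompBddHb ξ m φ ∧
  ∀ f : ℕ → ℂ → ℂ, (∀ k, MemHb ξ m (f k) ∧ hbNormSq ξ m (f k) ≤ 1) →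
    ∃ (κ : ℕ → ℕ) (g : ℂ → ℂ), StrictMono κ ∧ MemHb ξ m g ∧
      Tendsto (fun i => hbNormSq ξ m fun z => f (κ i) (φ z) - g z) atTop (nhds 0)

/-- The composition operator `C_φ` is Hilbert–Schmidt on `H(b)`: it is bounded and the sum
of `⦀C_φ e⦀²` over the orthonormal basis `{a₁ z^k}ₖ ∪ {z^j}_{j<N}` of
`(H(b), ⦀·⦀_b)` is finite (the finite part of the sum being automatically finite). -/
def CompHSHb {n : ℕ} (ξ : Fin n → ℂ) (m : Fin n → ℕ) (φ : ℂ → ℂ) : Prop :=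
  CompBddHb ξ m φ ∧
  Summable fun k : ℕ => hbNormSq ξ m fun z => a1fun ξ m (φ z) * φ z ^ k

/-- The weighted composition operator `W_{u,φ} f = u · (f ∘ φ)` maps `H²` boundedly
into itself. -/
def WCompBddH2 (u φ : ℂ → ℂ) : Prop :=
  (∀ f, MemH2 f → MemH2 fun z => u z * f (φ z)) ∧
  ∃ C : ℝ, ∀ f, MemH2 f →
    h2NormSq (fun z => u z * f (φ z)) ≤ C * h2NormSq f

/-- The weighted composition operator `W_{u,φ}` is compact on `H²`. -/
def WCompCompactH2 (u φ : ℂ → ℂ) : Prop :=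
  WCompBddH2 u φ ∧
  ∀ f : ℕ → ℂ → ℂ, (∀ k, MemH2 (f k) ∧ h2NormSq (f k) ≤ 1) →
    ∃ (κ : ℕ → ℕ) (g : ℂ → ℂ), StrictMono κ ∧ MemH2 g ∧
      Tendsto (fun i => h2NormSq fun z => u z * f (κ i) (φ z) - g z) atTop (nhds 0)

/-- The weighted composition operator `W_{u,φ}` is Hilbert–Schmidt on `H²`
(sum over the orthonormal basis `{z^k}` of `H²`). -/
def WCompHSH2 (u φ : ℂ → ℂ) : Prop :=
  WCompBddH2 u φ ∧ Summable fun k : ℕ => h2NormSq fun z => u z * φ z ^ k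

/-- The function `u = (a₁ ∘ φ) · ∏_{j ≥ p} (φ − φ(ξⱼ))^{mⱼ} / a₁`, where `Λ j = φ(ξ j)`
are the non-tangential limits of `φ` at the zeros of the mate. -/
def ufun {n : ℕ} (p : ℕ) (ξ : Fin n → ℂ) (m : Fin n → ℕ) (Λ : Fin n → ℂ)
    (φ : ℂ → ℂ) : ℂ → ℂ :=
  fun z => a1fun ξ m (φ z) *
    (∏ j ∈ Finset.univ.filter fun j : Fin n => p ≤ (j : ℕ), (φ z - Λ j) ^ (m j)) /
      a1fun ξ m z

/-- The reproducing kernel of the de Branges–Rovnyak space `H(c)`: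
`k_λ^c(z) = (1 − conj(c(λ)) c(z)) / (1 − conj(λ) z)`, as a function of the parameter `λ`
and the evaluation point `z`. -/
def rkKernel (c : ℂ → ℂ) (lam z : ℂ) : ℂ :=
  (1 - (starRingEnd ℂ) (c lam) * c z) / (1 - (starRingEnd ℂ) lam * z)

/-- `f` belongs to the reproducing kernel Hilbert space `H(c)` with squared norm at
most `t`: for all finite linear combinations of kernels,
`|⟨f, Σ αᵢ k_{λᵢ}⟩|² ≤ t · ‖Σ αᵢ k_{λᵢ}‖²`. -/
def HbRKBound (c f : ℂ → ℂ) (t : ℝ) : Prop :=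
  ∀ (k : ℕ) (lam α : Fin k → ℂ), (∀ i, lam i ∈ unitDisk) →
    ‖∑ i, (starRingEnd ℂ) (α i) * f (lam i)‖ ^ 2 ≤
      t * (∑ i, ∑ j, α i * (starRingEnd ℂ) (α j) * rkKernel c (lam i) (lam j)).re

/-- Membership in the de Branges–Rovnyak space `H(c)` (general RKHS definition). -/
def MemHbRK (c f : ℂ → ℂ) : Prop := ∃ t : ℝ, HbRKBound c f t

/-- `φ` has an angular derivative in the sense of Carathéodory at `ξ`:
`φ` and `φ'` have non-tangential limits at `ξ` and `|φ(ξ)| = 1`. -/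
def HasADC (φ : ℂ → ℂ) (ξ : ℂ) : Prop :=
  ∃ L L' : ℂ, ‖L‖ = 1 ∧ NTLimit φ ξ L ∧ NTLimit (deriv φ) ξ L'

/-- The measure `μ_{u,φ}(E) = ∫_{φ⁻¹(E) ∩ T} |u|² dm` (boundary values on the circle,
normalized Lebesgue measure). -/
def muMeas (u φ : ℂ → ℂ) (E : Set ℂ) : ENNReal :=
  (ENNReal.ofReal (2 * Real.pi))⁻¹ *
    ∫⁻ θ in Set.Ioc (0:ℝ) (2 * Real.pi),
      (if bdryVal φ (Complex.exp (θ * Complex.I)) ∈ E then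
        ENNReal.ofReal (‖bdryVal u (Complex.exp (θ * Complex.I))‖ ^ 2) else 0)

/-- `μ_{u,φ}` is a Carleson measure: `μ(S(ζ,r)) ≤ M r` for all Carleson windows
`S(ζ,r) = {z : |z| ≤ 1, |z − ζ| ≤ r}`, `ζ ∈ T`, `0 < r < 1`. -/
def IsCarleson (u φ : ℂ → ℂ) : Prop :=
  ∃ M : ℝ, 0 < M ∧ ∀ ζ ∈ unitCircle, ∀ r ∈ Set.Ioo (0:ℝ) 1,
    muMeas u φ (Metric.closedBall ζ r ∩ Metric.closedBall 0 1) ≤ ENNReal.ofReal (M * r)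

/-- `μ_{u,φ}` is a vanishing Carleson measure: `sup_{ζ∈T} μ(S(ζ,r))/r → 0` as `r → 0`. -/
def IsVanishingCarleson (u φ : ℂ → ℂ) : Prop :=
  ∀ ε > (0:ℝ), ∃ r₀ ∈ Set.Ioo (0:ℝ) 1, ∀ r ∈ Set.Ioo (0:ℝ) r₀, ∀ ζ ∈ unitCircle,
    muMeas u φ (Metric.closedBall ζ r ∩ Metric.closedBall 0 1) ≤ ENNReal.ofReal (ε * r)

/-- The reproducing kernel integral
`∫_T (1 − |w|²) |u(ξ)|² / |1 − conj(w) φ(ξ)|² dm(ξ)`. -/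
def repKerInt (u φ : ℂ → ℂ) (w : ℂ) : ENNReal :=
  (ENNReal.ofReal (2 * Real.pi))⁻¹ *
    ∫⁻ θ in Set.Ioc (0:ℝ) (2 * Real.pi),
      ENNReal.ofReal ((1 - ‖w‖ ^ 2) * ‖bdryVal u (Complex.exp (θ * Complex.I))‖ ^ 2 /
        ‖1 - (starRingEnd ℂ) w * bdryVal φ (Complex.exp (θ * Complex.I))‖ ^ 2)

/-- Mean of `‖f‖²` over the circle of radius `r`. -/
def avgSq (f : ℂ → ℂ) (r : ℝ) : ℝ := Real.circleAverage (fun z => ‖f z‖ ^ 2) 0 r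

lemma hasSum_taylorCoeff {f : ℂ → ℂ} (hf : DifferentiableOn ℂ f unitDisk) {z : ℂ}
    (hz : z ∈ unitDisk) : HasSum (fun k => taylorCoeff f k * z ^ k) (f z) := by
  have h := Complex.hasSum_taylorSeries_on_ball hf hz
  have e : (fun k => taylorCoeff f k * z ^ k) = fun n : ℕ =>
      ((n.factorial : ℂ))⁻¹ • (z - 0) ^ n • iteratedDeriv n f 0 := by
    funext k
    simp [taylorCoeff, div_eq_mul_inv]
    ring
  rw [e]
  exact h

lemma circle_mem {r : ℝ} (h0 : 0 ≤ r) (h1 : r < 1) (θ : ℝ) : circleMap 0 r θ ∈ unitDisk := by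
  simp [unitDisk, abs_of_nonneg h0, h1]

lemma sphere_sub_disk {r : ℝ} (h0 : 0 ≤ r) (h1 : r < 1) : Metric.sphere (0:ℂ) |r| ⊆ unitDisk := by
  intro z hz
  simp only [mem_sphere_iff_norm, sub_zero] at hz
  simp [unitDisk, hz, abs_of_nonneg h0, h1]

lemma circInt_sq {f : ℂ → ℂ} (hf : DifferentiableOn ℂ f unitDisk) {r : ℝ} (h0 : 0 ≤ r)
    (h1 : r < 1) : CircleIntegrable (fun z => ‖f z‖ ^ 2) 0 r := by
  apply ContinuousOn.circleIntegrable'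
  exact ((hf.continuousOn.mono (sphere_sub_disk h0 h1)).norm.pow 2)

lemma parseval {f : ℂ → ℂ} (hf : DifferentiableOn ℂ f unitDisk) {r : ℝ} (h0 : 0 ≤ r)
    (h1 : r < 1) : HasSum (fun k => ‖taylorCoeff f k‖ ^ 2 * (r ^ 2) ^ k) (avgSq f r) := by
  rw [hasSum_iff_tendsto_nat_of_nonneg (fun k => by positivity)]
  have hS : Summable (fun k => ‖taylorCoeff f k‖ * r ^ k) := by
    have : ((r:ℂ)) ∈ unitDisk := by simp [unitDisk, abs_of_nonneg h0, h1]
    have h2 := (hasSum_taylorCoeff hf this).summable.norm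
    simpa [abs_of_nonneg h0] using h2
  set S := ∑' k, ‖taylorCoeff f k‖ * r ^ k with hSdef
  let p : ℕ → Polynomial ℂ := fun N =>
    ∑ k ∈ Finset.range N, Polynomial.monomial k (taylorCoeff f k * (r:ℂ) ^ k)
  have hcoeff : ∀ N k, (p N).coeff k = if k < N then taylorCoeff f k * (r:ℂ)^k else 0 := by
    intro N k
    simp [p, Polynomial.coeff_monomial]
  have key : ∀ N, ∑ k ∈ Finset.range N, ‖taylorCoeff f k‖ ^ 2 * (r ^ 2) ^ k
      = Real.circleAverage (fun z => ‖(p N).eval z‖ ^ 2) 0 1 := by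
    intro N
    rw [← Polynomial.sum_sq_norm_coeff_eq_circleAverage]
    have hsub : (p N).support ⊆ Finset.range N := by
      intro k hk
      rw [Polynomial.mem_support_iff, hcoeff] at hk
      by_contra h
      simp at h
      exact hk (by simp [h])
    rw [Finset.sum_subset hsub (fun k _ hk => by
      rw [Polynomial.notMem_support_iff] at hk; simp [hk])]
    apply Finset.sum_congr rfl
    intro k hk
    rw [hcoeff, if_pos (Finset.mem_range.1 hk), norm_mul, norm_pow, Complex.norm_real,
      Real.norm_of_nonneg h0]
    ring
  simp_rw [key]
  have hev : ∀ N (θ : ℝ), (p N).eval (circleMap 0 1 θ) =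
      ∑ k ∈ Finset.range N, taylorCoeff f k * (circleMap 0 r θ) ^ k := by
    intro N θ
    simp only [p, Polynomial.eval_finsetSum, Polynomial.eval_monomial]
    apply Finset.sum_congr rfl
    intro k _
    simp [circleMap, mul_pow]
    ring
  unfold avgSq Real.circleAverage
  apply Tendsto.const_smul
  apply intervalIntegral.tendsto_integral_filter_of_dominated_convergence (fun _ => S ^ 2)
  · refine Filter.Eventually.of_forall fun N => ?_
    apply Continuous.aestronglyMeasurable
    have := (p N).continuous
    fun_prop
  · refine Filter.Eventually.of_forall fun N => Filter.Eventually.of_forall fun θ _ => ?_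
    simp only [hev, norm_pow, norm_norm]
    gcongr
    calc _ ≤ ∑ k ∈ Finset.range N, ‖taylorCoeff f k‖ * r ^ k := by
          refine (norm_sum_le _ _).trans (le_of_eq ?_)
          apply Finset.sum_congr rfl
          intro k _
          simp [abs_of_nonneg h0]
      _ ≤ S := hS.sum_le_tsum _ (fun k _ => by positivity)
  · simp
  · refine Filter.Eventually.of_forall fun θ _ => ?_
    simp_rw [hev]
    exact ((hasSum_taylorCoeff hf (circle_mem h0 h1 θ)).tendsto_sum_nat.norm.pow 2)

lemma h2NormSq_nonneg (f : ℂ → ℂ) : 0 ≤ h2NormSq f := tsum_nonneg fun _ => by positivity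

lemma avgSq_le {f : ℂ → ℂ} (hf : MemH2 f) {r : ℝ} (h0 : 0 ≤ r) (h1 : r < 1) :
    avgSq f r ≤ h2NormSq f := by
  rw [← (parseval hf.1 h0 h1).tsum_eq]
  refine (parseval hf.1 h0 h1).summable.tsum_le_tsum (fun k => ?_) hf.2
  apply mul_le_of_le_one_right (by positivity)
  apply pow_le_one₀ (by positivity)
  exact pow_le_one₀ h0 h1.le

lemma memH2_of_avg {f : ℂ → ℂ} (hf : DifferentiableOn ℂ f unitDisk) {M r₀ : ℝ} (h0 : 0 ≤ r₀)
    (h1 : r₀ < 1) (h : ∀ r, r₀ < r → r < 1 → avgSq f r ≤ M) : MemH2 f ∧ h2NormSq f ≤ M := by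
  have hfin : ∀ s : Finset ℕ, ∑ k ∈ s, ‖taylorCoeff f k‖ ^ 2 ≤ M := by
    intro s
    have ht : Tendsto (fun r : ℝ => ∑ k ∈ s, ‖taylorCoeff f k‖ ^ 2 * (r ^ 2) ^ k)
        (nhdsWithin 1 (Set.Iio 1)) (nhds (∑ k ∈ s, ‖taylorCoeff f k‖ ^ 2)) := by
      have hc : Continuous (fun r : ℝ => ∑ k ∈ s, ‖taylorCoeff f k‖ ^ 2 * (r ^ 2) ^ k) := by
        fun_prop
      have := (hc.tendsto 1).mono_left (nhdsWithin_le_nhds (s := Set.Iio 1))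
      simpa using this
    apply le_of_tendsto ht
    filter_upwards [Ioo_mem_nhdsLT h1] with r hr
    refine le_trans ?_ (h r hr.1 hr.2)
    have hp := parseval hf (h0.trans hr.1.le) hr.2
    exact sum_le_hasSum s (fun k _ => by positivity) hp
  refine ⟨⟨hf, summable_of_sum_le (fun _ => by positivity) hfin⟩, ?_⟩
  exact Real.tsum_le_of_sum_le (fun _ => by positivity) hfin

lemma h2_dom {F G₁ G₂ : ℂ → ℂ} (hF : DifferentiableOn ℂ F unitDisk) (h₁ : MemH2 G₁)
    (h₂ : MemH2 G₂) {A B r₀ : ℝ} (hA : 0 ≤ A) (hB : 0 ≤ B) (hr : r₀ < 1)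
    (h : ∀ z ∈ unitDisk, r₀ < ‖z‖ → ‖F z‖ ^ 2 ≤ A * ‖G₁ z‖ ^ 2 + B * ‖G₂ z‖ ^ 2) :
    MemH2 F ∧ h2NormSq F ≤ A * h2NormSq G₁ + B * h2NormSq G₂ := by
  apply memH2_of_avg hF (r₀ := max r₀ 0) (le_max_right _ _) (max_lt hr one_pos)
  intro r hr₀ hr1
  have hr0 : 0 ≤ r := (le_max_right _ _).trans hr₀.le
  have hlt : r₀ < r := (le_max_left _ _).trans_lt hr₀
  have i1 := (circInt_sq h₁.1 hr0 hr1).const_smul (a := A)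
  have i2 := (circInt_sq h₂.1 hr0 hr1).const_smul (a := B)
  calc avgSq F r ≤ Real.circleAverage
        ((A • fun z => ‖G₁ z‖ ^ 2) + (B • fun z => ‖G₂ z‖ ^ 2)) 0 r := by
        apply Real.circleAverage_mono (circInt_sq hF hr0 hr1) (i1.add i2)
        intro z hz
        have hz' : ‖z‖ = r := by simpa [abs_of_nonneg hr0] using hz
        simpa using h z (sphere_sub_disk hr0 hr1 hz) (hz' ▸ hlt)
    _ = A * avgSq G₁ r + B * avgSq G₂ r := by
        rw [Real.circleAverage_add i1 i2, Real.circleAverage_smul, Real.circleAverage_smul]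
        rfl
    _ ≤ _ := by
        gcongr
        · exact avgSq_le h₁ hr0 hr1
        · exact avgSq_le h₂ hr0 hr1

lemma poisson_sq {f : ℂ → ℂ} (hf : DifferentiableOn ℂ f unitDisk) {R : ℝ} (hR0 : 0 < R)
    (hR : R < 1) {w : ℂ} (hw : w ∈ Metric.ball (0:ℂ) R) :
    ‖f w‖ ^ 2 ≤ Real.circleAverage (fun ζ => poissonKernel 0 w ζ * ‖f ζ‖ ^ 2) 0 R := by
  have hd : DiffContOnCl ℂ (fun z => f z ^ 2) (Metric.ball (0:ℂ) R) := by
    apply DifferentiableOn.diffContOnCl_ball (U := unitDisk) (hf.pow 2)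
    intro z hz
    simp only [Metric.mem_closedBall, dist_zero_right] at hz
    simp [unitDisk]; linarith
  have h := hd.circleAverage_poissonKernel_smul hw
  rw [← norm_pow, ← h]
  unfold Real.circleAverage
  rw [norm_smul, Real.norm_of_nonneg (by positivity), smul_eq_mul]
  gcongr
  refine (intervalIntegral.norm_integral_le_integral_norm (by positivity)).trans (le_of_eq ?_)
  apply intervalIntegral.integral_congr
  intro θ _
  have hpos : 0 ≤ poissonKernel 0 w (circleMap 0 R θ) := by
    unfold poissonKernel
    have : ‖w‖ < R := by simpa using hw
    simp only [sub_zero, norm_circleMap_zero, abs_of_pos hR0]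
    have : ‖w‖ ^ 2 ≤ R ^ 2 := by gcongr
    exact div_nonneg (by linarith) (by positivity)
  simp [abs_of_nonneg hpos]

lemma poisson_mean {φ : ℂ → ℂ} (hφ : DifferentiableOn ℂ φ unitDisk) {r R : ℝ} (h0 : 0 ≤ r)
    (h1 : r < 1) (hb : ∀ z ∈ Metric.closedBall (0:ℂ) r, ‖φ z‖ < R) {ζ : ℂ}
    (hζ : ‖ζ‖ = R) :
    Real.circleAverage (fun z => poissonKernel 0 (φ z) ζ) 0 r = poissonKernel 0 (φ 0) ζ := by
  have hne : ∀ z ∈ Metric.closedBall (0:ℂ) r, ζ - φ z ≠ 0 := by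
    intro z hz h
    have := hb z hz
    rw [← sub_eq_zero.1 h, hζ] at this
    exact lt_irrefl _ this
  have hsub : Metric.closedBall (0:ℂ) r ⊆ unitDisk := by
    intro z hz
    simp only [Metric.mem_closedBall, dist_zero_right] at hz
    simp [unitDisk]; linarith
  have hdo : DifferentiableOn ℂ (fun z => (ζ + φ z) / (ζ - φ z)) (Metric.ball (0:ℂ) r) := by
    have := hφ.mono (Metric.ball_subset_closedBall.trans hsub)
    exact ((differentiableOn_const ζ).add this).div ((differentiableOn_const ζ).sub this)
      (fun z hz => hne z (Metric.ball_subset_closedBall hz))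
  have hco : ContinuousOn (fun z => (ζ + φ z) / (ζ - φ z)) (Metric.closedBall (0:ℂ) r) := by
    have := (hφ.mono hsub).continuousOn
    exact (continuousOn_const.add this).div (continuousOn_const.sub this) hne
  have hd : DiffContOnCl ℂ (fun z => (ζ + φ z) / (ζ - φ z)) (Metric.ball (0:ℂ) |r|) := by
    rw [abs_of_nonneg h0]
    exact ⟨hdo, hco.mono Metric.closure_ball_subset_closedBall⟩
  have h := hd.circleAverage
  have hci : CircleIntegrable (fun z => (ζ + φ z) / (ζ - φ z)) 0 r := by
    apply ContinuousOn.circleIntegrable h0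
    exact hco.mono Metric.sphere_subset_closedBall
  have h2 := Complex.reCLM.circleAverage_comp_comm hci
  rw [h] at h2
  have e : ∀ z, poissonKernel 0 (φ z) ζ = ((ζ + φ z) / (ζ - φ z)).re := by
    intro z
    rw [poissonKernel_eq_re_herglotzRieszKernel]
    simp [herglotzRieszKernel]
  simp_rw [e]
  exact h2

lemma littlewood {f φ : ℂ → ℂ} (hf : MemH2 f) (hφ : DifferentiableOn ℂ φ unitDisk)
    (hmap : ∀ z ∈ unitDisk, φ z ∈ unitDisk) {r : ℝ} (h0 : 0 ≤ r) (h1 : r < 1) :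
    avgSq (fun z => f (φ z)) r ≤ 4 / (1 - ‖φ 0‖) * h2NormSq f := by
  have hsub : Metric.closedBall (0:ℂ) r ⊆ unitDisk := by
    intro z hz
    simp only [Metric.mem_closedBall, dist_zero_right] at hz
    simp [unitDisk]; linarith
  have hφ0 : ‖φ 0‖ < 1 := by simpa [unitDisk] using hmap 0 (by simp [unitDisk])
  obtain ⟨z₀, hz₀, hmax⟩ := (isCompact_closedBall (0:ℂ) r).exists_isMaxOn
    ⟨0, by simpa using h0⟩ ((hφ.mono hsub).continuousOn.norm)
  have hz₁ : ‖φ z₀‖ < 1 := by simpa [unitDisk] using hmap z₀ (hsub hz₀)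
  obtain ⟨R, hRl, hR1⟩ := exists_between (max_lt hz₁ (by linarith : (1 + ‖φ 0‖) / 2 < 1))
  have hRa := (le_max_left _ _).trans_lt hRl
  have hRb := (le_max_right _ _).trans_lt hRl
  have hn0 := norm_nonneg (φ 0)
  have hR0 : 0 < R := by linarith
  have hb : ∀ z ∈ Metric.closedBall (0:ℂ) r, ‖φ z‖ < R := fun z hz => (hmax hz).trans_lt hRa
  have hcm : ∀ θ, circleMap 0 r θ ∈ Metric.closedBall (0:ℂ) r := fun θ => by
    simp [abs_of_nonneg h0]
  have hcφ : Continuous (fun θ => φ (circleMap 0 r θ)) :=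
    (hφ.continuousOn.mono hsub).comp_continuous (continuous_circleMap 0 r) hcm
  have hcf : Continuous (fun η => f (circleMap 0 R η)) :=
    hf.1.continuousOn.comp_continuous (continuous_circleMap 0 R) (circle_mem hR0.le hR1)
  have hcK : Continuous (fun p : ℝ × ℝ => poissonKernel 0 (φ (circleMap 0 r p.1))
      (circleMap 0 R p.2) * ‖f (circleMap 0 R p.2)‖ ^ 2) := by
    unfold poissonKernel
    have c1 := hcφ.comp (continuous_fst (X := ℝ) (Y := ℝ))
    have c2 := hcf.comp (continuous_snd (X := ℝ) (Y := ℝ))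
    have c3 := (continuous_circleMap 0 R).comp (continuous_snd (X := ℝ) (Y := ℝ))
    simp only [Function.comp_def] at c1 c2 c3
    simp only [sub_zero]
    refine Continuous.mul (Continuous.div ((c3.norm.pow 2).sub (c1.norm.pow 2))
      ((c3.sub c1).norm.pow 2) ?_) (c2.norm.pow 2)
    intro p h
    have h' : circleMap 0 R p.2 = φ (circleMap 0 r p.1) := by
      simpa [sub_eq_zero] using h
    have := hb _ (hcm p.1)
    rw [← h'] at this
    simp [abs_of_pos hR0] at this
  have hfd : DifferentiableOn ℂ (fun z => f (φ z)) unitDisk := hf.1.comp hφ hmap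
  calc avgSq (fun z => f (φ z)) r
      ≤ Real.circleAverage (fun z => Real.circleAverage
          (fun ζ => poissonKernel 0 (φ z) ζ * ‖f ζ‖ ^ 2) 0 R) 0 r := by
        unfold avgSq
        apply Real.circleAverage_mono (circInt_sq hfd h0 h1)
        · apply Continuous.intervalIntegrable
          unfold Real.circleAverage
          exact (intervalIntegral.continuous_parametric_intervalIntegral_of_continuous'
            (f := fun θ η => poissonKernel 0 (φ (circleMap 0 r θ))
              (circleMap 0 R η) * ‖f (circleMap 0 R η)‖ ^ 2) hcK _ _).const_smul
                (2 * Real.pi)⁻¹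
        · intro z hz
          apply poisson_sq hf.1 hR0 hR1
          rw [abs_of_nonneg h0] at hz
          simpa using hb z (Metric.sphere_subset_closedBall hz)
    _ = Real.circleAverage (fun ζ => Real.circleAverage
          (fun z => poissonKernel 0 (φ z) ζ * ‖f ζ‖ ^ 2) 0 r) 0 R := by
        unfold Real.circleAverage
        simp only [intervalIntegral.integral_smul]
        congr 2
        refine MeasureTheory.intervalIntegral_intervalIntegral_swap ?_
        exact (hcK.continuousOn.integrableOn_compact
          (isCompact_uIcc.prod isCompact_uIcc)).mono_set
            (Set.prod_mono uIoc_subset_uIcc uIoc_subset_uIcc)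
    _ = Real.circleAverage (fun ζ => poissonKernel 0 (φ 0) ζ * ‖f ζ‖ ^ 2) 0 R := by
        apply Real.circleAverage_congr_sphere
        intro ζ hζ
        have hζ' : ‖ζ‖ = R := by simpa [abs_of_pos hR0] using hζ
        have := poisson_mean hφ h0 h1 hb hζ'
        simp only
        rw [← this]
        have e : (fun z => poissonKernel 0 (φ z) ζ * ‖f ζ‖ ^ 2)
            = (‖f ζ‖ ^ 2) • (fun z => poissonKernel 0 (φ z) ζ) := by
          funext z; simp [mul_comm]
        rw [e, Real.circleAverage_smul, smul_eq_mul, mul_comm]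
    _ ≤ Real.circleAverage ((4 / (1 - ‖φ 0‖)) • fun ζ => ‖f ζ‖ ^ 2) 0 R := by
        have hne : ∀ ζ ∈ Metric.sphere (0:ℂ) |R|, ‖ζ - φ 0‖ ^ 2 ≠ 0 := by
          intro ζ hζ h
          have h' : ζ = φ 0 := by simpa [sub_eq_zero] using h
          have : ‖ζ‖ = R := by simpa [abs_of_pos hR0] using hζ
          rw [h'] at this
          linarith
        apply Real.circleAverage_mono _ ((circInt_sq hf.1 hR0.le hR1).const_smul)
        · intro ζ hζ
          simp only [Pi.smul_apply, smul_eq_mul]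
          gcongr
          rw [abs_of_pos hR0] at hζ
          have := re_herglotzRieszKernel_le hζ (w := φ 0) (by simp; linarith)
          rw [poissonKernel_eq_re_herglotzRieszKernel]
          refine le_trans this ?_
          simp only [sub_zero]
          rw [div_le_div_iff₀ (by linarith) (by linarith)]
          nlinarith
        · apply ContinuousOn.circleIntegrable'
          have := hf.1.continuousOn.mono (sphere_sub_disk hR0.le hR1)
          unfold poissonKernel
          simp only [sub_zero]
          refine ContinuousOn.mul (ContinuousOn.div (by fun_prop) (by fun_prop) hne) (by fun_prop)
    _ = 4 / (1 - ‖φ 0‖) * avgSq f R := by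
        rw [Real.circleAverage_smul]; rfl
    _ ≤ _ := by
        have : 0 < 1 - ‖φ 0‖ := by linarith
        gcongr
        exact avgSq_le hf hR0.le hR1

lemma comp_h2 {f φ : ℂ → ℂ} (hf : MemH2 f) (hφ : DifferentiableOn ℂ φ unitDisk)
    (hmap : ∀ z ∈ unitDisk, φ z ∈ unitDisk) :
    MemH2 (fun z => f (φ z)) ∧ h2NormSq (fun z => f (φ z)) ≤ 4 / (1 - ‖φ 0‖) * h2NormSq f :=
  memH2_of_avg (hf.1.comp hφ hmap) le_rfl one_pos
    fun _ h0 h1 => littlewood hf hφ hmap h0.le h1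

lemma pointwise_h2 {f : ℂ → ℂ} (hf : MemH2 f) {w : ℂ} (hw : w ∈ unitDisk) :
    ‖f w‖ ^ 2 ≤ 4 / (1 - ‖w‖) * h2NormSq f := by
  have := littlewood hf (φ := fun _ => w) (differentiableOn_const w) (fun _ _ => hw) le_rfl one_pos
  simpa [avgSq] using this

lemma h2_congr {f g : ℂ → ℂ} (h : ∀ z ∈ unitDisk, f z = g z) : h2NormSq f = h2NormSq g := by
  have he : f =ᶠ[nhds 0] g := by
    filter_upwards [Metric.ball_mem_nhds (0:ℂ) one_pos] with z hz using h z hz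
  have : ∀ k, taylorCoeff f k = taylorCoeff g k := fun k => by
    unfold taylorCoeff
    rw [he.iteratedDeriv_eq]
  simp [h2NormSq, this]

lemma h2_bdd {F : ℂ → ℂ} (hF : DifferentiableOn ℂ F unitDisk) {K : ℝ}
    (h : ∀ z ∈ unitDisk, ‖F z‖ ≤ K) : MemH2 F ∧ h2NormSq F ≤ K ^ 2 := by
  apply memH2_of_avg hF le_rfl one_pos
  intro r h0 h1
  apply Real.circleAverage_mono_on_of_le_circle (circInt_sq hF h0.le h1)
  intro z hz
  have := h z (sphere_sub_disk h0.le h1 hz)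
  gcongr

lemma h2_bdd_mul {B g : ℂ → ℂ} (hB : DifferentiableOn ℂ B unitDisk) (hg : MemH2 g) {K : ℝ}
    (h : ∀ z ∈ unitDisk, ‖B z‖ ≤ K) :
    MemH2 (fun z => B z * g z) ∧ h2NormSq (fun z => B z * g z) ≤ K ^ 2 * h2NormSq g := by
  have := h2_dom (F := fun z => B z * g z) (hB.mul hg.1) hg hg (A := K ^ 2) (B := 0) (r₀ := 0)
    (by positivity) le_rfl one_pos (by
      intro z hz _
      have := h z hz
      simp only [norm_mul, mul_pow, zero_mul, add_zero]
      gcongr)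
  simpa using this

lemma h2_add {f g : ℂ → ℂ} (hf : MemH2 f) (hg : MemH2 g) :
    MemH2 (fun z => f z + g z) ∧
      h2NormSq (fun z => f z + g z) ≤ 2 * h2NormSq f + 2 * h2NormSq g := by
  apply h2_dom (F := fun z => f z + g z) (hf.1.add hg.1) hf hg zero_le_two zero_le_two one_pos
  intro z _ _
  have := norm_add_le (f z) (g z)
  have h0 := norm_nonneg (f z + g z)
  nlinarith [sq_nonneg (‖f z‖ - ‖g z‖)]

lemma poly_bdd (p : Polynomial ℂ) : ∃ K : ℝ, 0 ≤ K ∧ ∀ z ∈ unitDisk, ‖p.eval z‖ ≤ K := by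
  obtain ⟨K, hK⟩ := (isCompact_closedBall (0:ℂ) 1).exists_bound_of_continuousOn
    p.continuous.continuousOn
  refine ⟨K, (norm_nonneg _).trans (hK 0 (by simp)), fun z hz => hK z ?_⟩
  exact Metric.ball_subset_closedBall hz

lemma poly_diff (p : Polynomial ℂ) : DifferentiableOn ℂ (fun z => p.eval z) unitDisk :=
  p.differentiable.differentiableOn

lemma poly_h2 (p : Polynomial ℂ) : MemH2 (fun z => p.eval z) := by
  obtain ⟨K, _, hK⟩ := poly_bdd p
  exact (h2_bdd (poly_diff p) hK).1

lemma poly_mul_h2 (p : Polynomial ℂ) {g : ℂ → ℂ} (hg : MemH2 g) :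
    MemH2 (fun z => p.eval z * g z) := by
  obtain ⟨K, _, hK⟩ := poly_bdd p
  exact (h2_bdd_mul (poly_diff p) hg hK).1

lemma h2_dslope {l : ℂ} (hl : l ∈ unitDisk) : ∃ C : ℝ, 0 ≤ C ∧ ∀ f, MemH2 f →
    MemH2 (dslope f l) ∧ h2NormSq (dslope f l) ≤ C * h2NormSq f := by
  have hl' : ‖l‖ < 1 := by simpa [unitDisk] using hl
  have hn := norm_nonneg l
  set d := (1 - ‖l‖) / 2 with hd
  have hd0 : 0 < d := by rw [hd]; linarith
  have h1 := h2_bdd (F := fun _ => (1:ℂ)) (differentiableOn_const _) (K := 1) (by simp)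
  set A := 2 / d ^ 2 with hA
  have hA0 : 0 ≤ A := by positivity
  refine ⟨A + A * (4 / (1 - ‖l‖)), ?_, fun f hf => ?_⟩
  · have : 0 < 1 - ‖l‖ := by linarith
    positivity
  have hdiff : DifferentiableOn ℂ (dslope f l) unitDisk :=
    (Complex.differentiableOn_dslope (Metric.isOpen_ball.mem_nhds hl)).2 hf.1
  have := h2_dom hdiff hf h1.1 (A := A) (B := A * ‖f l‖ ^ 2) (r₀ := (1 + ‖l‖) / 2)
    hA0 (by positivity) (by linarith) (by
      intro z hz hzr
      have hzl : d ≤ ‖z - l‖ := by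
        have := norm_sub_norm_le z l
        rw [hd]; linarith
      have hne : z ≠ l := by
        rintro rfl
        simp at hzl; linarith
      rw [dslope_of_ne _ hne, slope_def_field, norm_div, div_pow]
      have h2 : ‖f z - f l‖ ^ 2 ≤ 2 * (‖f z‖ ^ 2 + ‖f l‖ ^ 2) := by
        have := norm_sub_le (f z) (f l)
        have h0 := norm_nonneg (f z - f l)
        nlinarith [sq_nonneg (‖f z‖ - ‖f l‖)]
      calc ‖f z - f l‖ ^ 2 / ‖z - l‖ ^ 2 ≤ 2 * (‖f z‖ ^ 2 + ‖f l‖ ^ 2) / d ^ 2 := by gcongr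
        _ = _ := by rw [hA]; simp; ring)
  refine ⟨this.1, this.2.trans ?_⟩
  have hp := pointwise_h2 hf hl
  have h1' : h2NormSq (fun _ => (1:ℂ)) ≤ 1 := by simpa using h1.2
  calc A * h2NormSq f + A * ‖f l‖ ^ 2 * h2NormSq (fun _ => (1:ℂ))
      ≤ A * h2NormSq f + A * (4 / (1 - ‖l‖) * h2NormSq f) * 1 := by
        gcongr
        · exact h2NormSq_nonneg _
        · exact mul_nonneg hA0 ((sq_nonneg _).trans hp)
    _ = _ := by ring

/-- The polynomial `∏ (X - ξ j) ^ m j`. -/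
def ppoly {n : ℕ} (ξ : Fin n → ℂ) (m : Fin n → ℕ) : Polynomial ℂ :=
  ∏ j, (Polynomial.X - Polynomial.C (ξ j)) ^ m j

lemma ppoly_induct {n : ℕ} (ξ : Fin n → ℂ) (m : Fin n → ℕ) {P : Polynomial ℂ → Prop} (h1 : P 1)
    (hs : ∀ j A, P A → P ((Polynomial.X - Polynomial.C (ξ j)) * A)) : P (ppoly ξ m) := by
  unfold ppoly
  have : ∀ s : Finset (Fin n), P (∏ j ∈ s, (Polynomial.X - Polynomial.C (ξ j)) ^ m j) := by
    intro s
    induction s using Finset.induction_on with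
    | empty => simpa using h1
    | insert j s hj ih =>
      rw [Finset.prod_insert hj]
      induction m j with
      | zero => simpa using ih
      | succ k ihk => rw [pow_succ', mul_assoc]; exact hs j _ ihk
  exact this _

lemma ppoly_eval {n : ℕ} (ξ : Fin n → ℂ) (m : Fin n → ℕ) (z : ℂ) :
    (ppoly ξ m).eval z = a1fun ξ m z := by
  simp [ppoly, a1fun, Polynomial.eval_prod]

lemma ppoly_monic {n : ℕ} (ξ : Fin n → ℂ) (m : Fin n → ℕ) : (ppoly ξ m).Monic :=
  Polynomial.monic_prod_of_monic _ _ fun j _ => (Polynomial.monic_X_sub_C _).pow _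

lemma ppoly_degree {n : ℕ} (ξ : Fin n → ℂ) (m : Fin n → ℕ) :
    (ppoly ξ m).degree = ((∑ j, m j : ℕ) : WithBot ℕ) := by
  rw [Polynomial.degree_eq_natDegree (ppoly_monic ξ m).ne_zero, ppoly,
    Polynomial.natDegree_prod_of_monic _ _ fun j _ => (Polynomial.monic_X_sub_C _).pow _]
  simp

lemma radial_mem {x : ℂ} (hx : ‖x‖ = 1) {r : ℝ} (hr : r ∈ Set.Ioo (0:ℝ) 1) :
    (r:ℂ) * x ∈ unitDisk := by
  simp [unitDisk, hx, abs_of_pos hr.1, hr.2]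

lemma radial_tendsto {x : ℂ} :
    Tendsto (fun r : ℝ => (r:ℂ) * x) (nhdsWithin 1 (Set.Iio 1)) (nhds x) := by
  have : Continuous (fun r : ℝ => (r:ℂ) * x) := by fun_prop
  simpa using (this.tendsto 1).mono_left (nhdsWithin_le_nhds (s := Set.Iio 1))

lemma radial_zero {g : ℂ → ℂ} (hg : MemH2 g) {x : ℂ} (hx : ‖x‖ = 1) :
    Tendsto (fun r : ℝ => ((r:ℂ) * x - x) * g ((r:ℂ) * x)) (nhdsWithin 1 (Set.Iio 1))
      (nhds 0) := by
  have h1 : Tendsto (fun r : ℝ => Real.sqrt (4 * (1 - r) * h2NormSq g))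
      (nhdsWithin 1 (Set.Iio 1)) (nhds 0) := by
    have : Continuous (fun r : ℝ => Real.sqrt (4 * (1 - r) * h2NormSq g)) := by fun_prop
    simpa using (this.tendsto 1).mono_left (nhdsWithin_le_nhds (s := Set.Iio 1))
  apply squeeze_zero_norm' _ h1
  filter_upwards [Ioo_mem_nhdsLT (zero_lt_one (α := ℝ))] with r hr
  apply Real.le_sqrt_of_sq_le
  have hp := pointwise_h2 hg (radial_mem hx hr)
  have hn : ‖(r:ℂ) * x‖ = r := by simp [hx, abs_of_pos hr.1]
  have hn2 : ‖(r:ℂ) * x - x‖ = 1 - r := by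
    have : (r:ℂ) * x - x = -(((1 - r : ℝ) : ℂ) * x) := by push_cast; ring
    rw [this, norm_neg, norm_mul, hx, Complex.norm_real, Real.norm_of_nonneg (by linarith [hr.2])]
    simp
  rw [norm_mul, mul_pow, hn2]
  rw [hn] at hp
  have h0 : 0 < 1 - r := by linarith [hr.2]
  calc (1 - r) ^ 2 * ‖g (r * x)‖ ^ 2 ≤ (1 - r) ^ 2 * (4 / (1 - r) * h2NormSq g) := by gcongr
    _ = _ := by field_simp

lemma ppoly_dvd {n : ℕ} (ξ : Fin n → ℂ) (m : Fin n → ℕ) (hξ : ∀ j, ‖ξ j‖ = 1) :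
    ∀ (g : ℂ → ℂ) (d : Polynomial ℂ), MemH2 g →
      (∀ z ∈ unitDisk, (ppoly ξ m).eval z * g z = d.eval z) → ppoly ξ m ∣ d := by
  apply ppoly_induct ξ m (P := fun A => ∀ (g : ℂ → ℂ) (d : Polynomial ℂ), MemH2 g →
      (∀ z ∈ unitDisk, A.eval z * g z = d.eval z) → A ∣ d)
  · intros; exact one_dvd _
  intro j A ih g d hg h
  have hroot : d.eval (ξ j) = 0 := by
    have t1 : Tendsto (fun r : ℝ => d.eval ((r:ℂ) * ξ j)) (nhdsWithin 1 (Set.Iio 1))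
        (nhds (d.eval (ξ j))) := (d.continuous.tendsto _).comp radial_tendsto
    have t2 : Tendsto (fun r : ℝ => A.eval ((r:ℂ) * ξ j)) (nhdsWithin 1 (Set.Iio 1))
        (nhds (A.eval (ξ j))) := (A.continuous.tendsto _).comp radial_tendsto
    have t3 := t2.mul (radial_zero hg (hξ j))
    rw [mul_zero] at t3
    refine tendsto_nhds_unique t1 (t3.congr' ?_)
    filter_upwards [Ioo_mem_nhdsLT (zero_lt_one (α := ℝ))] with r hr
    rw [← h _ (radial_mem (hξ j) hr)]
    simp
    ring
  obtain ⟨d', rfl⟩ := Polynomial.dvd_iff_isRoot.2 hroot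
  apply mul_dvd_mul_left
  apply ih g d' hg
  intro z hz
  have hne : z - ξ j ≠ 0 := by
    intro h0
    rw [sub_eq_zero.1 h0] at hz
    simp [unitDisk, hξ j] at hz
  have := h z hz
  simp only [Polynomial.eval_mul, Polynomial.eval_sub, Polynomial.eval_X, Polynomial.eval_C,
    mul_assoc] at this
  exact mul_left_cancel₀ hne this

lemma a1_ne {n : ℕ} {ξ : Fin n → ℂ} (m : Fin n → ℕ) (hξ : ∀ j, ‖ξ j‖ = 1) {z : ℂ}
    (hz : z ∈ unitDisk) : a1fun ξ m z ≠ 0 := by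
  unfold a1fun
  rw [Finset.prod_ne_zero_iff]
  intro j _
  apply pow_ne_zero
  intro h0
  rw [sub_eq_zero.1 h0] at hz
  simp [unitDisk, hξ j] at hz

lemma decomp_unique {n : ℕ} {ξ : Fin n → ℂ} {m : Fin n → ℕ} (hξ : ∀ j, ‖ξ j‖ = 1)
    {f g g' : ℂ → ℂ} {q q' : Polynomial ℂ} (h : HbDecompOf ξ m f g q)
    (h' : HbDecompOf ξ m f g' q') : q = q' ∧ ∀ z ∈ unitDisk, g z = g' z := by
  have hm : MemH2 (fun z => g z + (Polynomial.C (-1 : ℂ)).eval z * g' z) :=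
    (h2_add h.1 (poly_mul_h2 (Polynomial.C (-1)) h'.1)).1
  have hd := ppoly_dvd ξ m hξ _ (q' - q) hm (by
    intro z hz
    have e1 := h.2.2 z hz
    have e2 := h'.2.2 z hz
    rw [ppoly_eval]
    simp
    linear_combination e2 - e1)
  have hq : q' - q = 0 := by
    apply Polynomial.eq_zero_of_dvd_of_degree_lt hd
    rw [ppoly_degree]
    exact (Polynomial.degree_sub_le _ _).trans_lt (max_lt h'.2.1 h.2.1)
  have hq' : q = q' := (sub_eq_zero.1 hq).symm
  refine ⟨hq', fun z hz => ?_⟩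
  have e1 := h.2.2 z hz
  have e2 := h'.2.2 z hz
  rw [e1, hq'] at e2
  exact mul_left_cancel₀ (a1_ne m hξ hz) (add_right_cancel e2)

lemma hbDecomp_spec {n : ℕ} {ξ : Fin n → ℂ} {m : Fin n → ℕ} {f : ℂ → ℂ} (h : MemHb ξ m f) :
    HbDecompOf ξ m f (hbDecomp ξ m f).1 (hbDecomp ξ m f).2 := by
  unfold hbDecomp
  rw [dif_pos h]
  exact h.choose_spec

lemma hbNormSq_eq {n : ℕ} {ξ : Fin n → ℂ} {m : Fin n → ℕ} (hξ : ∀ j, ‖ξ j‖ = 1)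
    {f g : ℂ → ℂ} {q : Polynomial ℂ} (h : HbDecompOf ξ m f g q) :
    hbNormSq ξ m f = h2NormSq g + h2NormSq (fun z => q.eval z) := by
  have := decomp_unique hξ (hbDecomp_spec ⟨(g, q), h⟩) h
  unfold hbNormSq
  rw [this.1, h2_congr this.2]

/-- `F` has a decomposition whose squared norm is at most `M`. -/
def HbB {n : ℕ} (ξ : Fin n → ℂ) (m : Fin n → ℕ) (F : ℂ → ℂ) (M : ℝ) : Prop :=
  ∃ g q, HbDecompOf ξ m F g q ∧ h2NormSq g + h2NormSq (fun z => Polynomial.eval z q) ≤ M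

lemma HbB.add {n : ℕ} {ξ : Fin n → ℂ} {m : Fin n → ℕ} {F G : ℂ → ℂ} {M M' : ℝ}
    (h : HbB ξ m F M) (h' : HbB ξ m G M') : HbB ξ m (fun z => F z + G z) (2 * M + 2 * M') := by
  obtain ⟨g, q, hd, hb⟩ := h
  obtain ⟨g', q', hd', hb'⟩ := h'
  have h1 := h2_add hd.1 hd'.1
  have h2 := h2_add (poly_h2 q) (poly_h2 q')
  refine ⟨fun z => g z + g' z, q + q', ⟨h1.1, ?_, ?_⟩, ?_⟩
  · exact (Polynomial.degree_add_le _ _).trans_lt (max_lt hd.2.1 hd'.2.1)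
  · intro z hz
    simp only [hd.2.2 z hz, hd'.2.2 z hz, Polynomial.eval_add]
    ring
  · simp only [Polynomial.eval_add]
    linarith [h1.2, h2.2]

lemma HbB.smul {n : ℕ} {ξ : Fin n → ℂ} {m : Fin n → ℕ} {F : ℂ → ℂ} {M : ℝ}
    (h : HbB ξ m F M) (c : ℂ) : HbB ξ m (fun z => c * F z) (‖c‖ ^ 2 * M) := by
  obtain ⟨g, q, hd, hb⟩ := h
  have h1 := h2_bdd_mul (B := fun _ => c) (differentiableOn_const c) hd.1 (fun _ _ => le_rfl)
  have h2 := h2_bdd_mul (B := fun _ => c) (differentiableOn_const c) (poly_h2 q)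
    (fun _ _ => le_rfl)
  refine ⟨fun z => c * g z, Polynomial.C c * q, ⟨h1.1, ?_, ?_⟩, ?_⟩
  · refine lt_of_le_of_lt ?_ hd.2.1
    rw [← Polynomial.smul_eq_C_mul]
    exact Polynomial.degree_smul_le _ _
  · intro z hz
    simp only [hd.2.2 z hz, Polynomial.eval_mul, Polynomial.eval_C]
    ring
  · simp only [Polynomial.eval_mul, Polynomial.eval_C]
    have : ‖c‖ ^ 2 * (h2NormSq g + h2NormSq (fun z => Polynomial.eval z q)) ≤ ‖c‖ ^ 2 * M := by
      gcongr
    linarith [h1.2, h2.2]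

lemma HbB.congr {n : ℕ} {ξ : Fin n → ℂ} {m : Fin n → ℕ} {F G : ℂ → ℂ} {M M' : ℝ}
    (h : HbB ξ m F M) (e : ∀ z ∈ unitDisk, G z = F z) (hM : M ≤ M') : HbB ξ m G M' := by
  obtain ⟨g, q, hd, hb⟩ := h
  exact ⟨g, q, ⟨hd.1, hd.2.1, fun z hz => (e z hz).trans (hd.2.2 z hz)⟩, hb.trans hM⟩

lemma near_bound {n : ℕ} {ξ : Fin n → ℂ} (hξ : ∀ j, ‖ξ j‖ = 1) {φ : ℂ → ℂ}
    (hb : ∀ z ∈ unitDisk, ‖φ z‖ ≤ 1)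
    (hlimsup : ∀ j, Filter.limsup (fun z => ‖φ z‖) (nhdsWithin (ξ j) unitDisk) < 1) :
    ∃ ρ δ : ℝ, ρ < 1 ∧ 0 < δ ∧ ∀ j, ∀ z ∈ unitDisk, ‖z - ξ j‖ < δ → ‖φ z‖ ≤ ρ := by
  have h1 : ∀ j, ∃ ρ δ : ℝ, ρ < 1 ∧ 0 < δ ∧ ∀ z ∈ unitDisk, ‖z - ξ j‖ < δ → ‖φ z‖ ≤ ρ := by
    intro j
    obtain ⟨ρ, hρ, hρ1⟩ := exists_between (hlimsup j)
    have hbd : Filter.IsBoundedUnder (· ≤ ·) (nhdsWithin (ξ j) unitDisk) (fun z => ‖φ z‖) :=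
      ⟨1, by
        rw [Filter.eventually_map]
        filter_upwards [self_mem_nhdsWithin] with z hz using hb z hz⟩
    have hev := Filter.eventually_lt_of_limsup_lt hρ hbd
    rw [eventually_nhdsWithin_iff, Metric.eventually_nhds_iff] at hev
    obtain ⟨δ, hδ, h⟩ := hev
    exact ⟨ρ, δ, hρ1, hδ, fun z hz hd => (h (by rwa [dist_eq_norm]) hz).le⟩
  choose ρ δ hρ hδ h using h1
  rcases isEmpty_or_nonempty (Fin n) with hE | hE
  · exact ⟨0, 1, one_pos, one_pos, fun j => hE.elim j⟩
  obtain ⟨j1, hj1⟩ := Finite.exists_max ρ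
  obtain ⟨j2, hj2⟩ := Finite.exists_min δ
  exact ⟨ρ j1, δ j2, hρ j1, hδ j2, fun j z hz hd => (h j z hz (hd.trans_le (hj2 j))).trans (hj1 j)⟩

lemma lam_bound {n : ℕ} {ξ : Fin n → ℂ} {m : Fin n → ℕ} (hξ : ∀ j, ‖ξ j‖ = 1)
    (hm : ∀ j, 0 < m j) {φ g₀ : ℂ → ℂ} {q₀ : Polynomial ℂ} (hg₀ : MemH2 g₀)
    (hφe : ∀ z ∈ unitDisk, φ z = a1fun ξ m z * g₀ z + q₀.eval z) {ρ δ : ℝ} (hδ : 0 < δ)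
    (j : Fin n) (hρ : ∀ z ∈ unitDisk, ‖z - ξ j‖ < δ → ‖φ z‖ ≤ ρ) :
    ‖q₀.eval (ξ j)‖ ≤ ρ := by
  have hdvd : (Polynomial.X - Polynomial.C (ξ j)) ∣ ppoly ξ m :=
    (dvd_pow_self _ (hm j).ne').trans (Finset.dvd_prod_of_mem _ (Finset.mem_univ j))
  obtain ⟨A, hA⟩ := hdvd
  have t1 : Tendsto (fun r : ℝ => q₀.eval ((r:ℂ) * ξ j)) (nhdsWithin 1 (Set.Iio 1))
      (nhds (q₀.eval (ξ j))) := (q₀.continuous.tendsto _).comp radial_tendsto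
  have t2 : Tendsto (fun r : ℝ => A.eval ((r:ℂ) * ξ j)) (nhdsWithin 1 (Set.Iio 1))
      (nhds (A.eval (ξ j))) := (A.continuous.tendsto _).comp radial_tendsto
  have t3 := (t2.mul (radial_zero hg₀ (hξ j))).add t1
  rw [mul_zero, zero_add] at t3
  apply le_of_tendsto t3.norm
  have hnear : ∀ᶠ r : ℝ in nhdsWithin 1 (Set.Iio 1), (r:ℂ) * ξ j ∈ Metric.ball (ξ j) δ :=
    radial_tendsto.eventually (Metric.ball_mem_nhds _ hδ)
  filter_upwards [Ioo_mem_nhdsLT (zero_lt_one (α := ℝ)), hnear] with r hr hrn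
  have hz := radial_mem (hξ j) hr
  refine le_trans (le_of_eq ?_) (hρ _ hz (by simpa [dist_eq_norm] using hrn))
  rw [hφe _ hz, ← ppoly_eval, hA]
  congr 1
  simp
  ring

lemma poly_comp {n : ℕ} {ξ : Fin n → ℂ} {m : Fin n → ℕ} {φ g₀ : ℂ → ℂ} {q₀ : Polynomial ℂ}
    (hg₀ : MemH2 g₀) (hφ : DifferentiableOn ℂ φ unitDisk) (hb : ∀ z ∈ unitDisk, ‖φ z‖ ≤ 1)
    (hφe : ∀ z ∈ unitDisk, φ z = a1fun ξ m z * g₀ z + q₀.eval z) (Q : Polynomial ℂ) :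
    ∃ G, MemH2 G ∧ ∀ z ∈ unitDisk, Q.eval (φ z) = (ppoly ξ m).eval z * G z + (Q.comp q₀).eval z := by
  induction Q using Polynomial.induction_on' with
  | add p q hp hq =>
    obtain ⟨G, hG, e⟩ := hp
    obtain ⟨G', hG', e'⟩ := hq
    refine ⟨_, (h2_add hG hG').1, fun z hz => ?_⟩
    simp only [Polynomial.eval_add, Polynomial.add_comp, e z hz, e' z hz]
    ring
  | monomial k a =>
    induction k with
    | zero =>
      refine ⟨_, poly_h2 0, fun z hz => ?_⟩
      simp
    | succ k ih =>
      obtain ⟨G, hG, e⟩ := ih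
      refine ⟨_, (h2_add (h2_bdd_mul hφ hG hb).1
        (poly_mul_h2 ((Polynomial.monomial k a).comp q₀) hg₀)).1, fun z hz => ?_⟩
      have e1 := e z hz
      have e2 := hφe z hz
      rw [← ppoly_eval] at e2
      simp only [Polynomial.eval_monomial, Polynomial.eval_comp, pow_succ] at e1 ⊢
      linear_combination (φ z) * e1 + a * (q₀.eval z) ^ k * e2

lemma vanish_factor {n : ℕ} {ξ : Fin n → ℂ} {m : Fin n → ℕ} {φ : ℂ → ℂ} {q₀ : Polynomial ℂ}
    (hcomp : ∀ Q : Polynomial ℂ, ∃ G, MemH2 G ∧ ∀ z ∈ unitDisk,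
      Q.eval (φ z) = (ppoly ξ m).eval z * G z + (Q.comp q₀).eval z) :
    ∃ G, MemH2 G ∧ ∀ z ∈ unitDisk,
      (ppoly (fun j => q₀.eval (ξ j)) m).eval (φ z) = a1fun ξ m z * G z := by
  obtain ⟨G, hG, e⟩ := hcomp (ppoly (fun j => q₀.eval (ξ j)) m)
  have hdvd : ppoly ξ m ∣ (ppoly (fun j => q₀.eval (ξ j)) m).comp q₀ := by
    unfold ppoly
    rw [Polynomial.prod_comp]
    apply Finset.prod_dvd_prod_of_dvd
    intro j _
    rw [Polynomial.pow_comp]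
    apply pow_dvd_pow_of_dvd
    rw [Polynomial.dvd_iff_isRoot]
    simp
  obtain ⟨S, hS⟩ := hdvd
  refine ⟨_, (h2_add hG (poly_h2 S)).1, fun z hz => ?_⟩
  rw [e z hz, hS, ← ppoly_eval, Polynomial.eval_mul]
  ring

lemma poly_hb {n : ℕ} {ξ : Fin n → ℂ} {m : Fin n → ℕ} {φ : ℂ → ℂ} {q₀ : Polynomial ℂ}
    (hcomp : ∀ Q : Polynomial ℂ, ∃ G, MemH2 G ∧ ∀ z ∈ unitDisk,
      Q.eval (φ z) = (ppoly ξ m).eval z * G z + (Q.comp q₀).eval z) (Q : Polynomial ℂ) :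
    ∃ M, 0 ≤ M ∧ HbB ξ m (fun z => Q.eval (φ z)) M := by
  obtain ⟨G, hG, e⟩ := hcomp Q
  refine ⟨_, ?_, fun z => G z + ((Q.comp q₀) /ₘ ppoly ξ m).eval z, (Q.comp q₀) %ₘ ppoly ξ m,
    ⟨(h2_add hG (poly_h2 _)).1, ?_, fun z hz => ?_⟩, le_rfl⟩
  · exact add_nonneg (h2NormSq_nonneg _) (h2NormSq_nonneg _)
  · rw [← ppoly_degree ξ m]
    exact Polynomial.degree_modByMonic_lt _ (ppoly_monic ξ m)
  · simp only
    rw [e z hz, ← ppoly_eval]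
    conv_lhs => rw [← Polynomial.modByMonic_add_div (Q.comp q₀) (ppoly ξ m)]
    rw [Polynomial.eval_add, Polynomial.eval_mul]
    ring

lemma newton {n k : ℕ} {ξ : Fin n → ℂ} {m : Fin n → ℕ} {lam : Fin k → ℂ} {m' : Fin k → ℕ}
    {φ : ℂ → ℂ} {q₀ : Polynomial ℂ}
    (hcomp : ∀ Q : Polynomial ℂ, ∃ G, MemH2 G ∧ ∀ z ∈ unitDisk,
      Q.eval (φ z) = (ppoly ξ m).eval z * G z + (Q.comp q₀).eval z)
    (hlam : ∀ j, lam j ∈ unitDisk) (Q₀ : Polynomial ℂ) :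
    ∃ C : ℝ, 0 ≤ C ∧ ∀ f, MemH2 f → ∃ h, MemH2 h ∧ h2NormSq h ≤ C * h2NormSq f ∧
      HbB ξ m (fun z => Q₀.eval (φ z) * (f (φ z) - (ppoly lam m').eval (φ z) * h (φ z)))
        (C * h2NormSq f) := by
  revert Q₀
  apply ppoly_induct lam m' (P := fun P => ∀ Q₀ : Polynomial ℂ,
    ∃ C : ℝ, 0 ≤ C ∧ ∀ f, MemH2 f → ∃ h, MemH2 h ∧ h2NormSq h ≤ C * h2NormSq f ∧
      HbB ξ m (fun z => Q₀.eval (φ z) * (f (φ z) - P.eval (φ z) * h (φ z)))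
        (C * h2NormSq f))
  · intro Q₀
    refine ⟨1, zero_le_one, fun f hf => ⟨f, hf, by simp, ?_⟩⟩
    obtain ⟨M, hM, hB⟩ := poly_hb hcomp 0
    refine (hB.smul 0).congr (fun z _ => by simp) ?_
    simpa using h2NormSq_nonneg f
  intro j P ih Q₀
  obtain ⟨C', hC', hE⟩ := ih (Q₀ * (Polynomial.X - Polynomial.C (lam j)))
  obtain ⟨M, hM, hB⟩ := poly_hb hcomp Q₀
  obtain ⟨D, hD, hds⟩ := h2_dslope (hlam j)
  set D' := 4 / (1 - ‖lam j‖) with hD'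
  have hl' : ‖lam j‖ < 1 := by simpa [unitDisk] using hlam j
  have hD'0 : 0 ≤ D' := by
    have : 0 < 1 - ‖lam j‖ := by linarith
    positivity
  refine ⟨2 * (D' * M) + 2 * (C' * D), by positivity, fun f hf => ?_⟩
  have hd := hds f hf
  obtain ⟨h, hh, hhb, hHb⟩ := hE _ hd.1
  have hN := h2NormSq_nonneg f
  have hle : C' * h2NormSq (dslope f (lam j)) ≤ C' * D * h2NormSq f := by
    rw [mul_assoc]
    exact mul_le_mul_of_nonneg_left hd.2 hC'
  have p1 : 0 ≤ D' * M * h2NormSq f := by positivity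
  have p2 : 0 ≤ C' * D * h2NormSq f := by positivity
  refine ⟨h, hh, ?_, ((hB.smul (f (lam j))).add hHb).congr (fun z _ => ?_) ?_⟩
  · linarith
  · have := sub_smul_dslope f (lam j) (φ z)
    simp only [smul_eq_mul] at this
    simp only [Polynomial.eval_mul, Polynomial.eval_sub, Polynomial.eval_X, Polynomial.eval_C]
    linear_combination (-(Q₀.eval (φ z))) * this
  · have hp := mul_le_mul_of_nonneg_right (pointwise_h2 hf (hlam j)) hM
    rw [← hD'] at hp
    linarith

lemma weighted {n : ℕ} {ξ : Fin n → ℂ} {m : Fin n → ℕ} {φ G : ℂ → ℂ} {P : Polynomial ℂ}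
    (hξ : ∀ j, ‖ξ j‖ = 1) (hφ : DifferentiableOn ℂ φ unitDisk)
    (hmap : ∀ z ∈ unitDisk, φ z ∈ unitDisk) (hG : MemH2 G)
    (hPG : ∀ z ∈ unitDisk, P.eval (φ z) = a1fun ξ m z * G z) {ρ δ : ℝ} (hδ : 0 < δ)
    (hρ1 : ρ < 1) (hρ : ∀ j, ∀ z ∈ unitDisk, ‖z - ξ j‖ < δ → ‖φ z‖ ≤ ρ) :
    ∃ C : ℝ, 0 ≤ C ∧ ∀ h, MemH2 h → MemH2 (fun z => G z * h (φ z)) ∧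
      h2NormSq (fun z => G z * h (φ z)) ≤ C * h2NormSq h := by
  obtain ⟨K, hK0, hK⟩ := poly_bdd P
  set c := ∏ j, δ ^ m j with hc
  have hc0 : 0 < c := Finset.prod_pos fun j _ => by positivity
  have hφ0 : ‖φ 0‖ < 1 := by simpa [unitDisk] using hmap 0 (by simp [unitDisk])
  have hφ0' : 0 < 1 - ‖φ 0‖ := by linarith
  have hρ' : 0 < 1 - ρ := by linarith
  have hGn := h2NormSq_nonneg G
  refine ⟨4 / (1 - ρ) * h2NormSq G + (K / c) ^ 2 * (4 / (1 - ‖φ 0‖)), by positivity,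
    fun h hh => ?_⟩
  have hhn := h2NormSq_nonneg h
  have hL := comp_h2 hh hφ hmap
  have := h2_dom (F := fun z => G z * h (φ z)) (hG.1.mul hL.1.1) hG hL.1
    (A := 4 / (1 - ρ) * h2NormSq h) (B := (K / c) ^ 2) (r₀ := 0) (by positivity) (by positivity)
    one_pos (by
      intro z hz _
      rw [norm_mul, mul_pow]
      by_cases hn : ∃ j, ‖z - ξ j‖ < δ
      · obtain ⟨j, hj⟩ := hn
        have h1 := hρ j z hz hj
        have h2 := pointwise_h2 hh (hmap z hz)
        have h3 : ‖h (φ z)‖ ^ 2 ≤ 4 / (1 - ρ) * h2NormSq h := by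
          refine h2.trans ?_
          gcongr
        have h4 : 0 ≤ (K / c) ^ 2 * ‖h (φ z)‖ ^ 2 := by positivity
        have h5 := mul_le_mul_of_nonneg_left h3 (sq_nonneg ‖G z‖)
        linarith
      · push Not at hn
        have h1 : c ≤ ‖a1fun ξ m z‖ := by
          unfold a1fun
          rw [norm_prod, hc]
          apply Finset.prod_le_prod
          · intro j _; positivity
          · intro j _
            rw [norm_pow]
            exact pow_le_pow_left₀ hδ.le (hn j) _
        have h2 : ‖G z‖ ≤ K / c := by
          rw [le_div_iff₀ hc0]
          calc ‖G z‖ * c ≤ ‖G z‖ * ‖a1fun ξ m z‖ := by gcongr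
            _ = ‖P.eval (φ z)‖ := by rw [hPG z hz, norm_mul, mul_comm]
            _ ≤ K := hK _ (hmap z hz)
        have h3 : ‖G z‖ ^ 2 * ‖h (φ z)‖ ^ 2 ≤ (K / c) ^ 2 * ‖h (φ z)‖ ^ 2 := by gcongr
        have h4 : 0 ≤ 4 / (1 - ρ) * h2NormSq h * ‖G z‖ ^ 2 := by positivity
        linarith)
  refine ⟨this.1, this.2.trans ?_⟩
  have := mul_le_mul_of_nonneg_left hL.2 (sq_nonneg (K / c))
  linarith

/-- Corollary 4.12. If `φ ∈ H(b) ∩ ball(H^∞)` satisfies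
`limsup_{z→ξⱼ} |φ(z)| < 1` for every `j`, then `C_φ` is bounded on `H(b)`. -/
theorem comp_bounded_of_limsup_lt_one
    (b a : ℂ → ℂ) (n : ℕ) (ξ : Fin n → ℂ) (m : Fin n → ℕ)
    (hset : RationalSetting b a n ξ m)
    (φ : ℂ → ℂ) (hφb : MemHb ξ m φ) (hφball : MemBallHinf φ)
    (hφmap : ∀ z ∈ unitDisk, φ z ∈ unitDisk)
    (hlimsup : ∀ j, Filter.limsup (fun z => ‖φ z‖)
      (nhdsWithin (ξ j) unitDisk) < 1) :
    CompBddHb ξ m φ := by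
  have hξ : ∀ j, ‖ξ j‖ = 1 := fun j => by simpa [unitCircle] using hset.zeros_mem j
  obtain ⟨⟨g₀, q₀⟩, hg₀, hq₀, hφe⟩ := hφb
  dsimp only at hg₀ hq₀ hφe
  obtain ⟨ρ, δ, hρ1, hδ, hρ⟩ := near_bound hξ hφball.2 hlimsup
  have hlam : ∀ j, q₀.eval (ξ j) ∈ unitDisk := fun j => by
    have := lam_bound hξ hset.mult_pos hg₀ hφe hδ j (hρ j)
    simp only [unitDisk, mem_ball_zero_iff]
    exact this.trans_lt hρ1
  have hcomp := fun Q => poly_comp hg₀ hφball.1 hφball.2 hφe Q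
  set P := ppoly (fun j => q₀.eval (ξ j)) m with hP
  obtain ⟨G, hG, hPG⟩ := vanish_factor (ξ := ξ) (m := m) hcomp
  obtain ⟨C, hC, hE⟩ := newton (m' := m) hcomp hlam 1
  obtain ⟨C', hC', hK⟩ := weighted hξ hφball.1 hφmap hG hPG hδ hρ1 hρ
  obtain ⟨K, hK0, hKb⟩ := poly_bdd (ppoly ξ m)
  have main : ∀ f, MemHb ξ m f → HbB ξ m (fun z => f (φ z))
      ((2 * C + 2 * (C' * C)) * ((2 * K ^ 2 + 2) * hbNormSq ξ m f)) := by
    intro f hf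
    have hs := hbDecomp_spec hf
    have hn : hbNormSq ξ m f = h2NormSq (hbDecomp ξ m f).1 +
      h2NormSq fun z => ((hbDecomp ξ m f).2).eval z := rfl
    generalize hbDecomp ξ m f = gq at hs hn
    have k1 := h2_bdd_mul (poly_diff (ppoly ξ m)) hs.1 hKb
    have k2 := h2_add k1.1 (poly_h2 gq.2)
    set f' : ℂ → ℂ := fun z => (ppoly ξ m).eval z * gq.1 z + gq.2.eval z with hf'
    have hfM : h2NormSq f' ≤ (2 * K ^ 2 + 2) * hbNormSq ξ m f := by
      have a1 := h2NormSq_nonneg gq.1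
      have a2 := h2NormSq_nonneg (fun z => gq.2.eval z)
      have a3 : 0 ≤ K ^ 2 * h2NormSq (fun z => gq.2.eval z) := by positivity
      rw [hn]
      linarith [k1.2, k2.2]
    obtain ⟨h, hh, hhb, hB⟩ := hE f' k2.1
    have hW := hK h hh
    have hB2 : HbB ξ m (fun z => P.eval (φ z) * h (φ z)) (C' * h2NormSq h) := by
      refine ⟨fun z => G z * h (φ z), 0, ⟨hW.1, ?_, ?_⟩, ?_⟩
      · rw [Polynomial.degree_zero]; exact WithBot.bot_lt_coe _
      · intro z hz
        have e := hPG z hz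
        simp only at e ⊢
        rw [e]
        simp
        ring
      · have : h2NormSq (fun z => Polynomial.eval z (0 : Polynomial ℂ)) ≤ 0 := by
          have := h2_bdd (poly_diff 0) (K := 0) (by simp)
          simpa using this.2
        linarith [hW.2]
    refine (hB.add hB2).congr ?_ ?_
    · intro z hz
      have := hs.2.2 (φ z) (hφmap z hz)
      rw [this, ← ppoly_eval]
      simp [hf', hP]
    · have : C' * h2NormSq h ≤ C' * (C * h2NormSq f') := by gcongr
      have h3 : (2 * C + 2 * (C' * C)) * h2NormSq f' ≤
        (2 * C + 2 * (C' * C)) * ((2 * K ^ 2 + 2) * hbNormSq ξ m f) := by gcongr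
      linarith
  refine ⟨fun f hf => ?_, (2 * C + 2 * (C' * C)) * (2 * K ^ 2 + 2), fun f hf => ?_⟩
  · obtain ⟨g, q, hd, _⟩ := main f hf
    exact ⟨(g, q), hd⟩
  · obtain ⟨g, q, hd, hb⟩ := main f hf
    rw [hbNormSq_eq hξ hd, mul_assoc]
    exact hb

end
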